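/- arXiv:1809.07466 — 2 statements merged into one kernel-verified Lean document; each statement's English description precedes it below -/
import Mathlib

section
/- Let n be a positive integer and s ∈ (0, 2π). If U is an even real trigonometric polynomial of degree at most n such that m({t ∈ [-π, π] : |U(t)| ≤ 1}) ≥ 2π - s, then |U(0)| ≤ T_{2n}(sec(s/4)), where T_{2n} is the Chebyshev polynomial of the first kind of degree 2n. -/
open MeasureTheory Real Set

/-- The Chebyshev polynomial of the first kind of degree `m`, as a real function. -/
noncomputable def chebT (m : ℕ) (x : ℝ) : ℝ := (Polynomial.Chebyshev.T ℝ (m : ℤ)).eval x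

/-- `U : ℝ → ℝ` is a real trigonometric polynomial of degree at most `n`. -/
def IsRTrigPoly (n : ℕ) (U : ℝ → ℝ) : Prop :=
  ∃ a b : ℕ → ℝ, ∀ t : ℝ,
    U t = a 0 + ∑ k ∈ Finset.Icc 1 n, (a k * Real.cos (k * t) + b k * Real.sin (k * t))

open Polynomial in
theorem Polynomial.Chebyshev.eval_T_real_eq_sum_abs {n : ℕ} {w : ℝ} (hw : 1 ≤ w) :
    (Chebyshev.T ℝ n).eval w = ∑ i ∈ Finset.range (n + 1), ∏ j ∈ (Finset.range (n + 1)).erase i,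
      |(w - Chebyshev.node n j) / (Chebyshev.node n i - Chebyshev.node n j)| := by
  have hdeg : (Chebyshev.T ℝ n).degree < (Finset.range (n + 1)).card := by
    rw [Chebyshev.degree_T, Finset.card_range]
    exact_mod_cast Nat.lt_succ_self n
  rw [Lagrange.eq_interpolate (Chebyshev.strictAntiOn_node n).injOn hdeg, Lagrange.interpolate_apply,
    eval_finsetSum]
  refine Finset.sum_congr rfl fun i hi => ?_
  have hin : i ≤ n := Finset.mem_range_succ_iff.mp hi
  rw [eval_mul, eval_C, Chebyshev.eval_T_real_node (Finset.mem_Iic.mpr hin)]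
  simp only [Lagrange.basis, eval_prod, Lagrange.basisDivisor, eval_mul, eval_C, eval_sub, eval_X]
  rw [← Finset.abs_prod, Finset.prod_div_distrib, Finset.prod_mul_distrib, Finset.prod_inv_distrib,
    abs_div, abs_of_nonneg (Finset.prod_nonneg fun j _ =>
      sub_nonneg.mpr (Chebyshev.node_mem_Icc.2.trans hw))]
  set D := ∏ j ∈ (Finset.range (n + 1)).erase i, (Chebyshev.node n i - Chebyshev.node n j)
  have hD : |D| = (-1) ^ i * D := by
    rw [← abs_of_pos (Chebyshev.zero_lt_prod_node_sub_node hin), abs_mul, abs_neg_one_pow, one_mul]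
  rw [hD, div_eq_mul_inv, mul_inv, ← inv_pow, inv_neg_one]
  ring

open Polynomial in
/-- If the Lagrange basis factors of the nodes `x i` at `u` are dominated by those of the Chebyshev
nodes at `w`, then a polynomial bounded by one at the nodes `x i` satisfies `|P u| ≤ T_n w`. -/
theorem Polynomial.Chebyshev.abs_eval_le_eval_T_of_nodes {n : ℕ} {P : ℝ[X]} (hP : P.degree ≤ n)
    {u w : ℝ} (hw : 1 ≤ w) {x : ℕ → ℝ} (hx : Set.InjOn x (Finset.range (n + 1)))
    (hbound : ∀ i ≤ n, |P.eval (x i)| ≤ 1)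
    (hcomp : ∀ i ≤ n, ∀ j ≤ n, j ≠ i → |(u - x j) / (x i - x j)| ≤
      |(w - Chebyshev.node n j) / (Chebyshev.node n i - Chebyshev.node n j)|) :
    |P.eval u| ≤ (Chebyshev.T ℝ n).eval w := by
  have hdeg : P.degree < (Finset.range (n + 1)).card := by
    rw [Finset.card_range]
    exact hP.trans_lt (by exact_mod_cast Nat.lt_succ_self n)
  rw [Polynomial.Chebyshev.eval_T_real_eq_sum_abs hw, Lagrange.eq_interpolate hx hdeg,
    Lagrange.interpolate_apply, eval_finsetSum]
  refine (Finset.abs_sum_le_sum_abs _ _).trans (Finset.sum_le_sum fun i hi => ?_)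
  have hin : i ≤ n := Finset.mem_range_succ_iff.mp hi
  rw [eval_mul, eval_C, abs_mul]
  simp only [Lagrange.basis, eval_prod, Lagrange.basisDivisor, eval_mul, eval_C, eval_sub, eval_X]
  rw [Finset.abs_prod]
  refine (mul_le_of_le_one_left (Finset.prod_nonneg fun _ _ => abs_nonneg _) (hbound i hin)).trans
    (Finset.prod_le_prod (fun _ _ => abs_nonneg _) fun j hj => ?_)
  rw [Finset.mem_erase, Finset.mem_range_succ_iff] at hj
  rw [inv_mul_eq_div]
  exact hcomp i hin j hj.2 hj.1

/-- Translating a pair of angles to the left while widening the gap decreases the ratio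
`sin (α / 2) / sin (β / 2)`, here in terms of `1 - cos`. -/
theorem one_sub_cos_mul_le {α β φ ψ : ℝ} (hα : 0 ≤ α) (hβψ : β ≤ ψ) (hψ : ψ ≤ π) (hφψ : φ ≤ ψ)
    (hgap : ψ - φ ≤ β - α) :
    (1 - cos α) * (1 - cos ψ) ≤ (1 - cos φ) * (1 - cos β) := by
  have hsq : ∀ t, 1 - cos t = 2 * sin (t / 2) ^ 2 := fun t => by
    rw [sin_sq_eq_half_sub]
    ring_nf
  have h1 : sin (α / 2) ≤ sin ((φ - (ψ - β)) / 2) :=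
    sin_le_sin_of_le_of_le_pi_div_two (by linarith [pi_pos]) (by linarith) (by linarith)
  have hα0 : 0 ≤ sin (α / 2) := sin_nonneg_of_nonneg_of_le_pi (by linarith) (by linarith)
  have hψ0 : 0 ≤ sin (ψ / 2) := sin_nonneg_of_nonneg_of_le_pi (by linarith) (by linarith)
  have h2 : sin ((φ - (ψ - β)) / 2) * sin (ψ / 2) ≤ sin (φ / 2) * sin (β / 2) := by
    have hc : 0 ≤ sin ((ψ - β) / 2) := sin_nonneg_of_nonneg_of_le_pi (by linarith) (by linarith)
    have hd : 0 ≤ sin ((ψ - φ) / 2) := sin_nonneg_of_nonneg_of_le_pi (by linarith) (by linarith)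
    have hb : sin (β / 2) = sin (ψ / 2 - (ψ - β) / 2) := by congr 1; ring
    have hp : sin ((φ - (ψ - β)) / 2) = sin (φ / 2 - (ψ - β) / 2) := by congr 1; ring
    have hq : sin ((ψ - φ) / 2) = sin (ψ / 2 - φ / 2) := by congr 1; ring
    rw [sin_sub] at hb hp hq
    rw [hb, hp]
    rw [hq] at hd
    nlinarith [mul_nonneg hc hd]
  have h3 : sin (α / 2) * sin (ψ / 2) ≤ sin (φ / 2) * sin (β / 2) :=
    (mul_le_mul_of_nonneg_right h1 hψ0).trans h2
  have h4 := pow_le_pow_left₀ (mul_nonneg hα0 hψ0) h3 2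
  simp only [hsq]
  nlinarith

/-- Comparison of the Lagrange factors at `1` of nodes `cos α < 1` after translation. -/
theorem abs_one_sub_cos_div_le {α β φ ψ : ℝ} (hα : 0 ≤ α) (hβψ : β ≤ ψ) (hψ : ψ ≤ π)
    (hφψ : φ < ψ) (hgap : ψ - φ ≤ β - α) :
    |(1 - cos α) / (cos β - cos α)| ≤ |(1 - cos φ) / (cos ψ - cos φ)| ∧
    |(1 - cos β) / (cos α - cos β)| ≤ |(1 - cos ψ) / (cos φ - cos ψ)| := by
  have key := one_sub_cos_mul_le hα hβψ hψ hφψ.le hgap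
  have h1 : cos β < cos α := cos_lt_cos_of_nonneg_of_le_pi hα (by linarith) (by linarith)
  have h2 : cos ψ < cos φ := cos_lt_cos_of_nonneg_of_le_pi (by linarith) hψ hφψ
  simp only [abs_div, abs_of_neg (sub_neg.mpr h1), abs_of_neg (sub_neg.mpr h2),
    abs_of_pos (sub_pos.mpr h1), abs_of_pos (sub_pos.mpr h2),
    abs_of_nonneg (sub_nonneg.mpr (cos_le_one _))]
  constructor
  · rw [div_le_div_iff₀ (by linarith) (by linarith)]
    nlinarith
  · rw [div_le_div_iff₀ (by linarith) (by linarith)]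
    nlinarith

theorem volume_real_inter_Ici_le {E : Set ℝ} (hE : IsCompact E) (a b : ℝ) :
    volume.real (E ∩ Ici a) ≤ volume.real (E ∩ Ici b) + volume.real (E ∩ Ico a b) := by
  have hsub : E ∩ Ici a ⊆ (E ∩ Ici b) ∪ (E ∩ Ico a b) := by
    rintro t ⟨htE, hta⟩
    rcases lt_or_ge t b with h | h
    · exact Or.inr ⟨htE, hta, h⟩
    · exact Or.inl ⟨htE, h⟩
  have hfin : ∀ s : Set ℝ, volume (E ∩ s) ≠ ⊤ := fun s =>
    ((measure_mono inter_subset_left).trans_lt hE.measure_lt_top).ne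
  refine (measureReal_mono hsub ?_).trans (measureReal_union_le _ _)
  rw [← inter_union_distrib_left]
  exact hfin _

theorem volume_real_inter_Ici_le_add {E : Set ℝ} (hE : IsCompact E) {a b : ℝ} (hab : a ≤ b) :
    volume.real (E ∩ Ici a) ≤ volume.real (E ∩ Ici b) + (b - a) := by
  refine (volume_real_inter_Ici_le hE a b).trans ?_
  gcongr
  refine (measureReal_mono (s₂ := Ico a b) inter_subset_right (by simp)).trans ?_
  rw [Real.volume_real_Ico_of_le hab]

theorem volume_real_inter_Ici_anti {E : Set ℝ} (hE : IsCompact E) {a b : ℝ} (hab : a ≤ b) :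
    volume.real (E ∩ Ici b) ≤ volume.real (E ∩ Ici a) :=
  measureReal_mono (inter_subset_inter_right _ (Ici_subset_Ici.mpr hab))
    ((measure_mono inter_subset_left).trans_lt hE.measure_lt_top).ne

/-- The tail measures of a compact set of reals at its own points take every intermediate value. -/
theorem exists_mem_volume_real_inter_Ici_eq {E : Set ℝ} (hE : IsCompact E) (hne : E.Nonempty)
    {v : ℝ} (hv0 : 0 ≤ v) (hv : v ≤ volume.real E) :
    ∃ t ∈ E, volume.real (E ∩ Ici t) = v := by
  set g : ℝ → ℝ := fun t => volume.real (E ∩ Ici t) with hg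
  have hlip : ∀ a b, a ≤ b → g a ≤ g b + (b - a) := fun a b => volume_real_inter_Ici_le_add hE
  have hanti : Antitone g := fun a b => volume_real_inter_Ici_anti hE
  have hcont : Continuous g := by
    refine (LipschitzWith.of_le_add fun a b => ?_).continuous
    rw [Real.dist_eq]
    rcases le_total a b with h | h
    · exact (hlip a b h).trans (by rw [abs_sub_comm]; gcongr; exact le_abs_self _)
    · exact (hanti h).trans (le_add_of_nonneg_right (abs_nonneg _))
  have hK : IsCompact (E ∩ {t | v ≤ g t}) :=
    hE.inter_right (isClosed_le continuous_const hcont)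
  obtain ⟨m, hmE, hm⟩ := hE.exists_isLeast hne
  have hgm : g m = volume.real E := by
    simp only [hg]
    rw [inter_eq_left.mpr (show E ⊆ Ici m from fun t ht => hm ht)]
  obtain ⟨t, ⟨htE, hvt⟩, ht⟩ := hK.exists_isGreatest ⟨m, hmE, by simpa [hgm] using hv⟩
  refine ⟨t, htE, le_antisymm (not_lt.mp fun hlt => ?_) hvt⟩
  change v < g t at hlt
  obtain ⟨M, hME, hM⟩ := hE.exists_isGreatest hne
  have hgM : g M = 0 := by
    have : E ∩ Ici M ⊆ {M} := fun x hx => le_antisymm (hM hx.1) hx.2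
    simp only [hg]
    rw [measureReal_def, measure_mono_null this (by simp), ENNReal.toReal_zero]
  obtain ⟨r, hr, hgr⟩ := intermediate_value_Icc' (hM htE) hcont.continuousOn
    (show (v + g t) / 2 ∈ Icc (g M) (g t) from ⟨by linarith, by linarith⟩)
  have hpos : 0 < volume.real (E ∩ Ico t r) := by
    have := volume_real_inter_Ici_le hE t r
    change g t ≤ g r + _ at this
    linarith
  have hex : ∃ x ∈ E ∩ Ico t r, x ≠ t := by
    by_contra! hcon
    have : E ∩ Ico t r ⊆ {t} := hcon
    rw [measureReal_def, measure_mono_null this (by simp), ENNReal.toReal_zero] at hpos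
    exact hpos.false
  obtain ⟨x, ⟨hxE, hxt, hxr⟩, hne⟩ := hex
  have : x ≤ t := ht ⟨hxE, by
    have := hanti hxr.le
    change v ≤ g x
    linarith⟩
  exact hne (le_antisymm this hxt)

theorem IsRTrigPoly.exists_polynomial_of_even {n : ℕ} {U : ℝ → ℝ} (hU : IsRTrigPoly n U)
    (heven : ∀ t, U (-t) = U t) :
    ∃ P : Polynomial ℝ, P.degree ≤ n ∧ ∀ t, U t = P.eval (cos t) := by
  obtain ⟨a, b, h⟩ := hU
  refine ⟨Polynomial.C (a 0) +
    ∑ k ∈ Finset.Icc 1 n, Polynomial.C (a k) * Polynomial.Chebyshev.T ℝ k, ?_, fun t => ?_⟩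
  · refine (Polynomial.degree_add_le _ _).trans (max_le ?_ ?_)
    · exact Polynomial.degree_C_le.trans (by exact_mod_cast Nat.zero_le n)
    · refine (Polynomial.degree_sum_le _ _).trans (Finset.sup_le fun k hk => ?_)
      rw [← Polynomial.smul_eq_C_mul]
      refine (Polynomial.degree_smul_le _ _).trans ?_
      rw [Polynomial.Chebyshev.degree_T]
      exact_mod_cast (Finset.mem_Icc.mp hk).2
  · have hsum : U t = (U t + U (-t)) / 2 := by rw [heven]; ring
    rw [hsum, h, h]
    simp only [Polynomial.eval_add, Polynomial.eval_C, Polynomial.eval_finsetSum,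
      Polynomial.eval_mul, Polynomial.Chebyshev.T_real_cos, mul_neg, cos_neg, sin_neg,
      Finset.sum_add_distrib, Finset.sum_neg_distrib, Int.cast_natCast]
    ring

open Polynomial in
/-- Remez inequality at an endpoint, with the exceptional set measured in the angular variable. -/
theorem Polynomial.abs_eval_one_le_eval_T {n : ℕ} {P : ℝ[X]} (hP : P.degree ≤ n) {s : ℝ}
    (hs : s ∈ Ioo 0 (2 * π))
    (hvol : π - s / 2 ≤ volume.real {t | t ∈ Icc 0 π ∧ |P.eval (cos t)| ≤ 1}) :
    |P.eval 1| ≤ (Chebyshev.T ℝ n).eval (2 * (1 / cos (s / 4)) ^ 2 - 1) := by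
  set E := {t | t ∈ Icc 0 π ∧ |P.eval (cos t)| ≤ 1} with hEdef
  have hE : IsCompact E :=
    isCompact_Icc.inter_right (isClosed_le (P.continuous.comp continuous_cos).abs continuous_const)
  have hne : E.Nonempty := by
    by_contra hcon
    rw [not_nonempty_iff_eq_empty.mp hcon, measureReal_empty] at hvol
    linarith [hs.2]
  set κ := cos (s / 4) with hκ
  have hκ0 : 0 < κ := cos_pos_of_mem_Ioo ⟨by linarith [hs.1, pi_pos], by linarith [hs.2]⟩
  have hκ1 : κ ≤ 1 := cos_le_one _
  have hκsq : κ ^ 2 ≤ 1 := pow_le_one₀ hκ0.le hκ1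
  set y : ℕ → ℝ := fun i => κ ^ 2 * (1 + Chebyshev.node n i) - 1 with hy
  have hy_mem : ∀ i, y i ∈ Icc (-1) (2 * κ ^ 2 - 1) := fun i => by
    have h := @Chebyshev.node_mem_Icc n i
    constructor
    · simp only [hy]
      nlinarith [h.1, sq_nonneg κ]
    · simp only [hy]
      nlinarith [h.2, sq_nonneg κ]
  set φ : ℕ → ℝ := fun i => arccos (y i) with hφ
  have hcosφ : ∀ i, cos (φ i) = y i := fun i =>
    cos_arccos (hy_mem i).1 ((hy_mem i).2.trans (by linarith))
  have hφπ : ∀ i, φ i ≤ π := fun i => arccos_le_pi _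
  have hφs : ∀ i, s / 2 ≤ φ i := fun i => by
    have hcos : cos (s / 2) = 2 * κ ^ 2 - 1 := by
      rw [hκ, ← cos_two_mul]
      ring_nf
    rw [← arccos_cos (x := s / 2) (by linarith [hs.1]) (by linarith [hs.2]), hcos]
    exact arccos_le_arccos (hy_mem i).2
  choose θ hθE hθ using fun i => exists_mem_volume_real_inter_Ici_eq hE hne
    (v := π - φ i) (by linarith [hφπ i]) (by linarith [hφs i])
  have hθφ : ∀ i, θ i ≤ φ i := fun i => by
    have : volume.real (E ∩ Ici (θ i)) ≤ π - θ i := by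
      rw [← Real.volume_real_Icc_of_le (hθE i).1.2]
      exact measureReal_mono (fun t ht => ⟨ht.2, ht.1.1.2⟩) (by simp)
    rw [hθ] at this
    linarith
  have hφlt : ∀ i j, j ≤ n → i < j → φ i < φ j := fun i j hj hij => by
    refine arccos_lt_arccos (hy_mem j).1 ?_ ((hy_mem i).2.trans (by linarith))
    simp only [hy]
    have := Chebyshev.node_lt hj hij
    gcongr
  have hgap : ∀ i j, j ≤ n → i < j → φ j - φ i ≤ θ j - θ i := fun i j hj hij => by
    have hlt := hφlt i j hj hij
    have hle : θ i ≤ θ j := by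
      by_contra! hcon
      have := volume_real_inter_Ici_anti hE hcon.le
      rw [hθ, hθ] at this
      linarith
    have := volume_real_inter_Ici_le_add hE hle
    rw [hθ, hθ] at this
    linarith
  have hw : 1 ≤ 2 * (1 / κ) ^ 2 - 1 := by
    have : 1 ≤ (1 / κ) ^ 2 := one_le_pow₀ ((one_le_div hκ0).mpr hκ1)
    linarith
  have hratio : ∀ i j, (1 - cos (φ j)) / (cos (φ i) - cos (φ j)) =
      (2 * (1 / κ) ^ 2 - 1 - Chebyshev.node n j) /
        (Chebyshev.node n i - Chebyshev.node n j) := fun i j => by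
    have h1 : 1 - y j = κ ^ 2 * (2 * (1 / κ) ^ 2 - 1 - Chebyshev.node n j) := by
      simp only [hy]
      field_simp
      ring
    have h2 : y i - y j = κ ^ 2 * (Chebyshev.node n i - Chebyshev.node n j) := by
      simp only [hy]
      ring
    rw [hcosφ, hcosφ, h1, h2, mul_div_mul_left _ _ (by positivity)]
  refine Chebyshev.abs_eval_le_eval_T_of_nodes hP hw (x := fun i => cos (θ i)) ?_
    (fun i _ => (hθE i).2) fun i hi j hj hji => ?_
  · intro i hi j hj hij
    rw [Finset.mem_coe, Finset.mem_range_succ_iff] at hi hj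
    have hθij : θ i = θ j := injOn_cos (hθE i).1 (hθE j).1 hij
    by_contra hne
    rcases lt_or_gt_of_ne hne with h | h
    · linarith [hgap i j hj h, hφlt i j hj h]
    · linarith [hgap j i hi h, hφlt j i hi h]
  · rw [← hratio]
    rcases lt_or_gt_of_ne hji with h | h
    · exact (abs_one_sub_cos_div_le (hθE j).1.1 (hθφ i) (hφπ i) (hφlt j i hi h)
        (hgap j i hi h)).1
    · exact (abs_one_sub_cos_div_le (hθE i).1.1 (hθφ j) (hφπ j) (hφlt i j hj h)
        (hgap i j hj h)).2

theorem volume_le_two_mul_of_even {f : ℝ → ℝ} (heven : ∀ t, f (-t) = f t) (r c : ℝ) :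
    volume {t | t ∈ Icc (-r) r ∧ f t ≤ c} ≤ 2 * volume {t | t ∈ Icc 0 r ∧ f t ≤ c} := by
  set E := {t | t ∈ Icc 0 r ∧ f t ≤ c}
  have hsub : {t | t ∈ Icc (-r) r ∧ f t ≤ c} ⊆ E ∪ -E := by
    rintro t ⟨ht, hft⟩
    rcases le_total 0 t with h | h
    · exact Or.inl ⟨⟨h, ht.2⟩, hft⟩
    · exact Or.inr ⟨⟨by linarith, by linarith [ht.1]⟩, by rwa [heven]⟩
  refine (measure_mono hsub).trans ((measure_union_le _ _).trans ?_)
  rw [Measure.measure_neg, two_mul]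

theorem remez_even_real_trig_at_zero (n : ℕ) (hn : 0 < n) (s : ℝ)
    (hs : s ∈ Set.Ioo 0 (2 * π))
    (U : ℝ → ℝ) (hU : IsRTrigPoly n U) (hUeven : ∀ t : ℝ, U (-t) = U t)
    (hmeas : ENNReal.ofReal (2 * π - s) ≤
      volume {t : ℝ | t ∈ Set.Icc (-π) π ∧ |U t| ≤ 1}) :
    |U 0| ≤ chebT (2 * n) (1 / Real.cos (s / 4)) := by
  obtain ⟨P, hP, hUP⟩ := hU.exists_polynomial_of_even hUeven
  have hT : chebT (2 * n) (1 / cos (s / 4)) =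
      (Polynomial.Chebyshev.T ℝ n).eval (2 * (1 / cos (s / 4)) ^ 2 - 1) := by
    rw [chebT, Nat.cast_mul, mul_comm, Polynomial.Chebyshev.T_mul, Polynomial.eval_comp]
    simp [Polynomial.Chebyshev.T_two]
  rw [hT, hUP, cos_zero]
  refine Polynomial.abs_eval_one_le_eval_T hP hs ?_
  have h := hmeas.trans
    (volume_le_two_mul_of_even (f := fun t => |U t|) (fun t => by rw [hUeven]) π 1)
  simp only [hUP] at h
  set E := {t | t ∈ Icc 0 π ∧ |P.eval (cos t)| ≤ 1}
  have hfin : volume E ≠ ⊤ :=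
    ((measure_mono (show E ⊆ Icc 0 π from fun t ht => ht.1)).trans_lt (by simp)).ne
  have h' := (ENNReal.ofReal_le_iff_le_toReal (ENNReal.mul_ne_top (by simp) hfin)).mp h
  rw [ENNReal.toReal_mul, ENNReal.toReal_ofNat, ← measureReal_def] at h'
  linarith
end

section
/- For every r ∈ (0, 1) and every Lebesgue measurable set A ⊆ [1-2r, 1] with m(A) > 0, one has μ_{[1-2r,1]}(A) > r^{1/2} · μ_{[-1,1]}(A). -/
open MeasureTheory Real Set

/-- The measure `μ_{[a,b]}` of a set `A ⊆ [a,b]`. -/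
noncomputable def muInterval (a b : ℝ) (A : Set ℝ) : ℝ :=
  ∫ x in A, ((b - a) / 2) / Real.sqrt (((b - a) / 2) ^ 2 - (x - (a + b) / 2) ^ 2)

theorem integrableOn_arcsine_density {a b : ℝ} (hab : a < b) :
    IntegrableOn
      (fun x ↦ ((b - a) / 2) / √(((b - a) / 2) ^ 2 - (x - (a + b) / 2) ^ 2)) (Icc a b) := by
  rw [integrableOn_Icc_iff_integrableOn_Ioc]
  set s := (b - a) / 2 with hs
  set c := (a + b) / 2 with hc
  have hs0 : 0 < s := by rw [hs]; linarith
  refine intervalIntegral.integrableOn_deriv_of_nonneg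
    (g := fun x ↦ s * arcsin ((x - c) / s)) (by fun_prop) ?_ (fun x _ ↦ by positivity)
  intro x hx
  have h1 : (x - c) / s ≠ -1 := by
    have : -1 < (x - c) / s := by rw [lt_div_iff₀ hs0]; linarith [hx.1]
    exact this.ne'
  have h2 : (x - c) / s ≠ 1 := by
    have : (x - c) / s < 1 := by rw [div_lt_iff₀ hs0]; linarith [hx.2]
    exact this.ne
  have h := ((hasDerivAt_arcsin h1 h2).comp x
    (((hasDerivAt_id x).sub_const c).div_const s)).const_mul s
  refine h.congr_deriv ?_
  have key : 1 - ((x - c) / s) ^ 2 = (s ^ 2 - (x - c) ^ 2) / s ^ 2 := by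
    field_simp
  simp only [id] at *
  rw [key, sqrt_div' _ (by positivity), sqrt_sq hs0.le]
  field_simp

theorem sqrt_mul_arcsine_density_lt {r x : ℝ} (hr : r ∈ Ioo (0 : ℝ) 1)
    (hx : x ∈ Ioo (1 - 2 * r) 1) :
    √r * (((1 - -1) / 2) / √(((1 - -1) / 2) ^ 2 - (x - (-1 + 1) / 2) ^ 2)) <
      ((1 - (1 - 2 * r)) / 2) /
        √(((1 - (1 - 2 * r)) / 2) ^ 2 - (x - ((1 - 2 * r) + 1) / 2) ^ 2) := by
  obtain ⟨hr0, hr1⟩ := hr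
  obtain ⟨hx0, hx1⟩ := hx
  have e1 : ((1 - -1) / 2 : ℝ) ^ 2 - (x - (-1 + 1) / 2) ^ 2 = (1 - x) * (1 + x) := by ring
  have e2 : ((1 - (1 - 2 * r)) / 2) ^ 2 - (x - ((1 - 2 * r) + 1) / 2) ^ 2
      = (1 - x) * (x - 1 + 2 * r) := by ring
  have p1 : 0 < (1 - x) * (1 + x) := mul_pos (by linarith) (by linarith)
  have p2 : 0 < (1 - x) * (x - 1 + 2 * r) := mul_pos (by linarith) (by linarith)
  have e3 : (1 - (1 - 2 * r)) / 2 = √r * √r := by rw [mul_self_sqrt hr0.le]; ring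
  rw [e1, e2, e3, mul_div_assoc]
  refine mul_lt_mul_of_pos_left ?_ (sqrt_pos.2 hr0)
  rw [div_lt_div_iff₀ (sqrt_pos.2 p1) (sqrt_pos.2 p2), ← sqrt_mul hr0.le]
  norm_num
  refine sqrt_lt_sqrt p2.le ?_
  nlinarith [mul_pos (sub_pos.2 hx1) (mul_pos (sub_pos.2 hx1) (sub_pos.2 hr1))]

theorem mu_right_subinterval_gt (r : ℝ) (hr : r ∈ Set.Ioo (0 : ℝ) 1) (A : Set ℝ)
    (hA : A ⊆ Set.Icc (1 - 2 * r) 1) (hAm : MeasurableSet A) (hA0 : 0 < volume A) :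
    Real.sqrt r * muInterval (-1) 1 A < muInterval (1 - 2 * r) 1 A := by
  have hsub : Icc (1 - 2 * r) 1 ⊆ Icc (-1) 1 := Icc_subset_Icc_left (by linarith [hr.2])
  have hI := (integrableOn_arcsine_density (a := 1 - 2 * r) (b := 1)
    (by linarith [hr.1])).mono_set hA
  have hJ := ((integrableOn_arcsine_density (a := -1) (b := 1)
    (by norm_num)).mono_set (hA.trans hsub)).const_mul √r
  have hlt := (ae_restrict_of_ae_restrict_of_subset hA
    ((ae_restrict_congr_set Ioo_ae_eq_Icc).mp
      (ae_restrict_of_forall_mem (μ := volume) measurableSet_Ioo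
        fun x hx ↦ sqrt_mul_arcsine_density_lt hr hx)))
  unfold muInterval
  rw [← integral_const_mul]
  have hle := hlt.mono fun x hx ↦ hx.le
  refine (integral_mono_ae hJ hI hle).lt_of_ne fun heq ↦ hA0.ne' ?_
  have hEq := (integral_eq_iff_of_ae_le hJ hI hle).1 heq
  have hFalse : ∀ᵐ x ∂volume.restrict A, False := by
    filter_upwards [hlt, hEq] with x h1 h2 using h1.ne h2
  simpa using hFalse
end
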